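/- Assume x̄ ≠ 0, σ(b̂) ≠ 0, σ''(b̂) ≠ 0, and a ≠ 0 (so A₁₂ ≠ 0). Suppose ε_{w₁}, ε_{b₁} : ℝ → ℝ are differentiable and satisfy the variational equations along γ, and set g_{w₁}(τ) = ε_{w₁}(−(1/ω)log τ) for τ > 0. Then at every τ > 0 with A₁₂τ+B₁₂ ≠ 0, g_{w₁}' is differentiable and g_{w₁}''(τ) = P₁(τ)g_{w₁}'(τ) + P₂(τ)g_{w₁}(τ), where P₁(τ) = A₁₁τ+B₁₁ + (A₁₂τ+B₁₂)⁻¹(A₁₂ + (A₁₂τ+B₁₂)A₂₂τ) and P₂(τ) = A₁₁ + (A₁₂τ+B₁₂)² − (A₁₂τ+B₁₂)⁻¹(A₁₁τ+B₁₁)(A₁₂ + (A₁₂τ+B₁₂)A₂₂τ). -/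

import Mathlib

open Finset

/-- A sum of residuals against a linear combination of two features, expressed through moments. -/
lemma sum_residual_mul_linear_combination {ι : Type*} [Fintype ι] (c m k u v : ℝ)
    (y p q : ι → ℝ) :
    ∑ i, (c + m - y i) * k * (p i * u + q i * v) =
      k * (((c + m) * ∑ i, p i - ∑ i, p i * y i) * u +
        ((c + m) * ∑ i, q i - ∑ i, q i * y i) * v) := by
  simp only [mul_sum, sum_mul, ← sum_sub_distrib, ← sum_add_distrib]
  exact sum_congr rfl fun i _ => by ring

/-- The change of time `t = -(1/ω) log τ` in a derivative. -/
lemma HasDerivAt.comp_neg_inv_mul_log {f : ℝ → ℝ} {f' ω τ : ℝ} (hτ : 0 < τ)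
    (hf : HasDerivAt f f' (-(1 / ω) * Real.log τ)) :
    HasDerivAt (fun s => f (-(1 / ω) * Real.log s)) (f' * (-(1 / ω) * τ⁻¹)) τ :=
  hf.comp τ ((Real.hasDerivAt_log hτ.ne').const_mul _)

/-- Elimination of `h` from the planar linear system `g' = p g + q h`, `h' = q g + r h` wherever
`q` does not vanish. -/
lemma hasDerivAt_deriv_of_planar_system {g h p q r : ℝ → ℝ} {p' q' τ : ℝ}
    (hg : ∀ᶠ s in nhds τ, HasDerivAt g (p s * g s + q s * h s) s)
    (hh : HasDerivAt h (q τ * g τ + r τ * h τ) τ)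
    (hp : HasDerivAt p p' τ) (hq : HasDerivAt q q' τ) (hq0 : q τ ≠ 0) :
    HasDerivAt (deriv g)
      ((p τ + (q τ)⁻¹ * (q' + q τ * r τ)) * deriv g τ +
        (p' + q τ ^ 2 - (q τ)⁻¹ * p τ * (q' + q τ * r τ)) * g τ) τ := by
  have hgτ := hg.self_of_nhds
  have hderiv : deriv g =ᶠ[nhds τ] fun s => p s * g s + q s * h s := hg.mono fun s hs => hs.deriv
  refine (((hp.mul hgτ).add (hq.mul hh)).congr_of_eventuallyEq hderiv).congr_deriv ?_
  rw [hgτ.deriv]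
  field_simp
  ring

/-- The function `g_{w₁}(τ) = ε_{w₁}(−(1/ω) log τ)` obtained from the variational
equation along `γ` satisfies a second-order linear ODE
`g'' = P₁ g' + P₂ g` wherever `τ > 0` and `A₁₂ τ + B₁₂ ≠ 0`. -/
theorem gw_satisfies_second_order_ode
    (N : ℕ) (hN : 1 ≤ N) (x y : Fin N → ℝ)
    (σ : ℝ → ℝ) (hσ : ContDiff ℝ 2 σ)
    (bhat : ℝ) (hbhat : deriv σ bhat = 0) (bhat₂ : ℝ)
    (xbar ybar x2bar xybar x2ybar a ω : ℝ)
    (hxbar : xbar = (∑ i, x i) / N)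
    (hybar : ybar = (∑ i, y i) / N)
    (hx2bar : x2bar = (∑ i, (x i) ^ 2) / N)
    (hxybar : xybar = (∑ i, x i * y i) / N)
    (hx2ybar : x2ybar = (∑ i, (x i) ^ 2 * y i) / N)
    (ha : a = bhat₂ - ybar)
    (hω : ω = N * (σ bhat ^ 2 + 1))
    (hxbar_ne : xbar ≠ 0) (hσb : σ bhat ≠ 0) (hσ'' : deriv (deriv σ) bhat ≠ 0)
    (ha_ne : a ≠ 0)
    (εw εb : ℝ → ℝ)
    (hεw : ∀ t : ℝ, HasDerivAt εw
      (-(∑ i, (a * (ω / N) * Real.exp (-(ω * t)) + ybar - y i) *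
          (a * σ bhat * deriv (deriv σ) bhat * Real.exp (-(ω * t))) *
          ((x i) ^ 2 * εw t + x i * εb t))) t)
    (hεb : ∀ t : ℝ, HasDerivAt εb
      (-(∑ i, (a * (ω / N) * Real.exp (-(ω * t)) + ybar - y i) *
          (a * σ bhat * deriv (deriv σ) bhat * Real.exp (-(ω * t))) *
          (x i * εw t + εb t))) t)
    (gw : ℝ → ℝ)
    (hgw : ∀ τ : ℝ, gw τ = εw (-(1 / ω) * Real.log τ))
    (A₁₁ B₁₁ A₁₂ B₁₂ A₂₂ : ℝ)
    (hA₁₁ : A₁₁ = a ^ 2 * σ bhat * deriv (deriv σ) bhat * x2bar)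
    (hB₁₁ : B₁₁ = (N / ω) * a * σ bhat * deriv (deriv σ) bhat * (x2bar * ybar - x2ybar))
    (hA₁₂ : A₁₂ = a ^ 2 * σ bhat * deriv (deriv σ) bhat * xbar)
    (hB₁₂ : B₁₂ = (N / ω) * a * σ bhat * deriv (deriv σ) bhat * (xbar * ybar - xybar))
    (hA₂₂ : A₂₂ = a ^ 2 * σ bhat * deriv (deriv σ) bhat) :
    ∀ τ : ℝ, 0 < τ → A₁₂ * τ + B₁₂ ≠ 0 →
      HasDerivAt (deriv gw)
        ((A₁₁ * τ + B₁₁ + (A₁₂ * τ + B₁₂)⁻¹ *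
            (A₁₂ + (A₁₂ * τ + B₁₂) * (A₂₂ * τ))) * deriv gw τ +
          (A₁₁ + (A₁₂ * τ + B₁₂) ^ 2 -
            (A₁₂ * τ + B₁₂)⁻¹ * (A₁₁ * τ + B₁₁) *
              (A₁₂ + (A₁₂ * τ + B₁₂) * (A₂₂ * τ))) * gw τ) τ := by
  intro τ hτ hτ0
  have hN0 : (N : ℝ) ≠ 0 := by exact_mod_cast (by omega : N ≠ 0)
  have hω0 : ω ≠ 0 := by rw [hω]; positivity
  have hx : ∑ i, x i = N * xbar := by rw [hxbar]; field_simp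
  have hy : ∑ i, y i = N * ybar := by rw [hybar]; field_simp
  have hx2 : ∑ i, x i ^ 2 = N * x2bar := by rw [hx2bar]; field_simp
  have hxy : ∑ i, x i * y i = N * xybar := by rw [hxybar]; field_simp
  have hx2y : ∑ i, x i ^ 2 * y i = N * x2ybar := by rw [hx2ybar]; field_simp
  have hexp : ∀ s : ℝ, 0 < s → Real.exp (-(ω * (-(1 / ω) * Real.log s))) = s := fun s hs => by
    rw [show -(ω * (-(1 / ω) * Real.log s)) = Real.log s by field_simp, Real.exp_log hs]
  obtain rfl : gw = fun s => εw (-(1 / ω) * Real.log s) := funext hgw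
  have hg : ∀ s : ℝ, 0 < s → HasDerivAt (fun s => εw (-(1 / ω) * Real.log s))
      ((A₁₁ * s + B₁₁) * εw (-(1 / ω) * Real.log s) +
        (A₁₂ * s + B₁₂) * εb (-(1 / ω) * Real.log s)) s := fun s hs => by
    refine ((hεw _).comp_neg_inv_mul_log hs).congr_deriv ?_
    rw [hexp s hs, sum_residual_mul_linear_combination, hx2, hx2y, hx, hxy,
      hA₁₁, hB₁₁, hA₁₂, hB₁₂]
    field_simp
    ring
  have hh : HasDerivAt (fun s => εb (-(1 / ω) * Real.log s))
      ((A₁₂ * τ + B₁₂) * εw (-(1 / ω) * Real.log τ) +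
        A₂₂ * τ * εb (-(1 / ω) * Real.log τ)) τ := by
    refine ((hεb _).comp_neg_inv_mul_log hτ).congr_deriv ?_
    have hsum := sum_residual_mul_linear_combination (a * (ω / N) * τ) ybar
      (a * σ bhat * deriv (deriv σ) bhat * τ) (εw (-(1 / ω) * Real.log τ))
      (εb (-(1 / ω) * Real.log τ)) y x (fun _ => 1)
    simp only [one_mul, sum_const, card_univ, Fintype.card_fin, nsmul_eq_mul, mul_one] at hsum
    rw [hexp τ hτ, hsum, hx, hxy, hy, hA₁₂, hB₁₂, hA₂₂]
    field_simp
    ring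
  have haff : ∀ A B : ℝ, HasDerivAt (fun s => A * s + B) A τ := fun A B => by
    simpa using ((hasDerivAt_id τ).const_mul A).add_const B
  exact hasDerivAt_deriv_of_planar_system (r := fun s => A₂₂ * s)
    ((eventually_gt_nhds hτ).mono hg) hh (haff A₁₁ B₁₁) (haff A₁₂ B₁₂) hτ0
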